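/- For every f ∈ L²(μ), T₊f(z) − T₋f(z) = w(z)·f(z) for Lebesgue-almost every z ∈ 𝕋, where w is the density of the absolutely continuous part of μ with respect to normalized Lebesgue measure. -/

import Mathlib

open MeasureTheory Complex Filter Metric
open scoped ComplexConjugate ENNReal NNReal Topology

noncomputable section

/-- Normalized Lebesgue (arclength) measure on the unit circle, as a measure on `ℂ`. -/
def circleMeasure : Measure ℂ :=
  (ENNReal.ofReal (2 * Real.pi)⁻¹) •
    Measure.map (fun t : ℝ => Complex.exp (t * Complex.I))
      (volume.restrict (Set.Ioc 0 (2 * Real.pi)))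

/-- `f` has nontangential limit `L` at the boundary point `z` from inside the unit disc:
convergence along every Stolz angle at `z`. -/
def NTlimIn (f : ℂ → ℂ) (z L : ℂ) : Prop :=
  ∀ C : ℝ, 1 < C →
    Tendsto f (𝓝[{w : ℂ | ‖w‖ < 1 ∧ ‖w - z‖ ≤ C * (1 - ‖w‖)}] z) (𝓝 L)

/-- `f` has nontangential limit `L` at the boundary point `z` from outside the unit disc. -/
def NTlimOut (f : ℂ → ℂ) (z L : ℂ) : Prop :=
  ∀ C : ℝ, 1 < C →
    Tendsto f (𝓝[{w : ℂ | 1 < ‖w‖ ∧ ‖w - z‖ ≤ C * (‖w‖ - 1)}] z) (𝓝 L)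

/-- The Poisson kernel of the unit disc at radius `r`, as a function of the chordal distance
between the two boundary points. -/
def chordalPoisson (r d : ℝ) : ℝ := (1 - r ^ 2) / ((1 - r) ^ 2 + r * d ^ 2)

lemma chordalPoisson_denom_pos {r : ℝ} (h0 : 0 < r) (h1 : r < 1) (d : ℝ) :
    0 < (1 - r) ^ 2 + r * d ^ 2 := by
  have : 0 < 1 - r := by linarith
  positivity

lemma one_sub_sq_pos {r : ℝ} (h0 : 0 < r) (h1 : r < 1) : 0 < 1 - r ^ 2 := by nlinarith

lemma chordalPoisson_nonneg {r : ℝ} (h0 : 0 < r) (h1 : r < 1) (d : ℝ) :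
    0 ≤ chordalPoisson r d :=
  div_nonneg (one_sub_sq_pos h0 h1).le (chordalPoisson_denom_pos h0 h1 d).le

lemma continuous_chordalPoisson {r : ℝ} (h0 : 0 < r) (h1 : r < 1) :
    Continuous (chordalPoisson r) :=
  Continuous.div (by fun_prop) (by fun_prop) fun d => (chordalPoisson_denom_pos h0 h1 d).ne'

lemma chordalPoisson_anti {r : ℝ} (h0 : 0 < r) (h1 : r < 1) {d e : ℝ} (hd : 0 ≤ d) (hde : d ≤ e) :
    chordalPoisson r e ≤ chordalPoisson r d := by
  unfold chordalPoisson
  have := one_sub_sq_pos h0 h1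
  have := chordalPoisson_denom_pos h0 h1 d
  gcongr

lemma tendsto_chordalPoisson {d : ℝ} (hd : 0 < d) :
    Tendsto (fun r => chordalPoisson r d) (𝓝[<] 1) (𝓝 0) := by
  have h : ContinuousAt (fun r => chordalPoisson r d) 1 := by
    unfold chordalPoisson
    refine ContinuousAt.div (by fun_prop) (by fun_prop) ?_
    have : 0 < d ^ 2 := by positivity
    norm_num
    exact hd.ne'
  have h' := h.tendsto
  simp only [chordalPoisson, one_pow, sub_self, zero_div] at h'
  exact h'.mono_left nhdsWithin_le_nhds

lemma chordalPoisson_superlevel {r : ℝ} (h0 : 0 < r) (h1 : r < 1) (z : ℂ) (δ : ℝ) {t : ℝ}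
    (ht : 0 < t) :
    ∃ s ≤ δ, {ξ | t ≤ chordalPoisson r ‖ξ - z‖} ∩ closedBall z δ = closedBall z s := by
  set A := ((1 - r ^ 2) / t - (1 - r) ^ 2) / r with hA
  have key : ∀ d, t ≤ chordalPoisson r d ↔ d ^ 2 ≤ A := by
    intro d
    rw [chordalPoisson, le_div_iff₀ (chordalPoisson_denom_pos h0 h1 d), hA, le_div_iff₀ h0,
      le_sub_iff_add_le (b := (1 - r) ^ 2), le_div_iff₀ ht]
    constructor <;> intro h <;> linarith
  rcases lt_or_ge A 0 with hneg | hpos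
  · refine ⟨min δ (-1), min_le_left _ _, ?_⟩
    rw [closedBall_eq_empty.2 (lt_of_le_of_lt (min_le_right _ _) (by norm_num))]
    ext ξ
    simp only [Set.mem_inter_iff, Set.mem_ofPred_eq, key, Set.mem_empty_iff_false, iff_false]
    rintro ⟨h, -⟩
    nlinarith [sq_nonneg ‖ξ - z‖]
  · refine ⟨min (Real.sqrt A) δ, min_le_right _ _, ?_⟩
    ext ξ
    simp only [Set.mem_inter_iff, Set.mem_ofPred_eq, key, mem_closedBall, dist_eq_norm, le_min_iff]
    rw [Real.le_sqrt (norm_nonneg _) hpos]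

lemma measure_singleton_le_of_closedBall_le {ρ σ : Measure ℂ} [IsFiniteMeasure σ] {z : ℂ} {δ : ℝ}
    (hδ : 0 < δ) (h : ∀ s, 0 < s → s ≤ δ → ρ (closedBall z s) ≤ σ (closedBall z s)) :
    ρ {z} ≤ σ {z} := by
  have ht := tendsto_measure_cthickening_of_isClosed (μ := σ) (s := {z})
    ⟨1, one_pos, measure_ne_top _ _⟩ isClosed_singleton
  refine ge_of_tendsto (ht.mono_left (nhdsWithin_le_nhds (s := Set.Ioi 0))) ?_
  filter_upwards [Ioc_mem_nhdsGT hδ] with s hs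
  rw [cthickening_singleton _ hs.1.le]
  exact (measure_mono (by simpa using hs.1.le)).trans (h s hs.1 hs.2)

/-- Comparison of Poisson integrals of two measures, one of which is dominated by the other on
small balls. -/
lemma lintegral_chordalPoisson_le {ρ σ : Measure ℂ} [IsFiniteMeasure σ]
    {z : ℂ} {δ : ℝ} (hδ : 0 < δ)
    (h : ∀ s, 0 < s → s ≤ δ → ρ (closedBall z s) ≤ σ (closedBall z s))
    {r : ℝ} (h0 : 0 < r) (h1 : r < 1) :
    ∫⁻ ξ, ENNReal.ofReal (chordalPoisson r ‖ξ - z‖) ∂ρ ≤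
      ∫⁻ ξ, ENNReal.ofReal (chordalPoisson r ‖ξ - z‖) ∂σ
        + ENNReal.ofReal (chordalPoisson r δ) * ρ Set.univ := by
  have hball : ∀ s ≤ δ, ρ (closedBall z s) ≤ σ (closedBall z s) := by
    intro s hs
    rcases lt_trichotomy s 0 with h' | h' | h'
    · simp [closedBall_eq_empty.2 h']
    · subst h'
      simpa using measure_singleton_le_of_closedBall_le hδ h
    · exact h s h' hs
  have hcont : Continuous fun ξ : ℂ => chordalPoisson r ‖ξ - z‖ :=
    (continuous_chordalPoisson h0 h1).comp (by fun_prop)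
  rw [← lintegral_add_compl _ (measurableSet_closedBall (x := z) (ε := δ))]
  refine add_le_add ?_ ?_
  · refine le_trans ?_ (setLIntegral_le_lintegral (closedBall z δ) _)
    rw [lintegral_eq_lintegral_meas_le _
        (Eventually.of_forall fun ξ => chordalPoisson_nonneg h0 h1 _) hcont.aemeasurable,
      lintegral_eq_lintegral_meas_le _
        (Eventually.of_forall fun ξ => chordalPoisson_nonneg h0 h1 _) hcont.aemeasurable]
    refine setLIntegral_mono' measurableSet_Ioi fun t ht => ?_
    rw [Measure.restrict_apply' measurableSet_closedBall,
      Measure.restrict_apply' measurableSet_closedBall]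
    obtain ⟨s, hs, hs'⟩ := chordalPoisson_superlevel h0 h1 z δ ht
    rw [hs']
    exact hball s hs
  · calc
      _ ≤ ∫⁻ _ in (closedBall z δ)ᶜ, ENNReal.ofReal (chordalPoisson r δ) ∂ρ := by
        refine setLIntegral_mono' measurableSet_closedBall.compl fun ξ hξ => ?_
        refine ENNReal.ofReal_le_ofReal (chordalPoisson_anti h0 h1 hδ.le ?_)
        simp only [Set.mem_compl_iff, mem_closedBall, dist_eq_norm, not_le] at hξ
        exact hξ.le
      _ ≤ _ := by
        rw [setLIntegral_const]
        gcongr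
        exact Set.subset_univ _

instance : IsFiniteMeasure circleMeasure := by
  unfold circleMeasure
  have : IsFiniteMeasure (volume.restrict (Set.Ioc 0 (2 * Real.pi))) := inferInstance
  exact Measure.smul_finite _ ENNReal.ofReal_ne_top

lemma ae_circleMeasure_norm_eq_one : ∀ᵐ z ∂circleMeasure, ‖z‖ = 1 := by
  unfold circleMeasure
  refine Measure.ae_smul_measure ?_ _
  rw [ae_map_iff (by fun_prop) (measurableSet_eq_fun (by fun_prop) (by fun_prop))]
  exact Eventually.of_forall fun t => Complex.norm_exp_ofReal_mul_I t

lemma norm_one_sub_mul_sq {r : ℝ} {ξ z : ℂ} (hξ : ‖ξ‖ = 1) (hz : ‖z‖ = 1) :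
    ‖ξ - r * z‖ ^ 2 = (1 - r) ^ 2 + r * ‖ξ - z‖ ^ 2 := by
  have e1 : ξ.re * ξ.re + ξ.im * ξ.im = 1 := by
    rw [← Complex.normSq_apply, Complex.normSq_eq_norm_sq, hξ, one_pow]
  have e2 : z.re * z.re + z.im * z.im = 1 := by
    rw [← Complex.normSq_apply, Complex.normSq_eq_norm_sq, hz, one_pow]
  rw [← Complex.normSq_eq_norm_sq, ← Complex.normSq_eq_norm_sq, Complex.normSq_apply,
    Complex.normSq_apply]
  simp
  linear_combination (1 - r) * e1 + (r ^ 2 - r) * e2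

lemma poissonKernel_eq_chordalPoisson {r : ℝ} {ξ z : ℂ} (hξ : ‖ξ‖ = 1) (hz : ‖z‖ = 1) :
    poissonKernel 0 (r * z) ξ = chordalPoisson r ‖ξ - z‖ := by
  rw [poissonKernel_def, sub_zero, sub_zero, norm_one_sub_mul_sq hξ hz, hξ, norm_mul, hz,
    chordalPoisson]
  simp

lemma lintegral_chordalPoisson_circleMeasure {r : ℝ} (h0 : 0 < r) (h1 : r < 1) {z : ℂ}
    (hz : ‖z‖ = 1) :
    ∫⁻ ξ, ENNReal.ofReal (chordalPoisson r ‖ξ - z‖) ∂circleMeasure = 1 := by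
  have hcont : Continuous fun ξ : ℂ => chordalPoisson r ‖ξ - z‖ :=
    (continuous_chordalPoisson h0 h1).comp (by fun_prop)
  have hP := DiffContOnCl.circleAverage_poissonKernel_smul (f := fun _ : ℂ => (1 : ℂ)) (c := 0)
    (R := 1) (w := r * z) diffContOnCl_const (by simp [hz, abs_of_pos h0, h1])
  have hint : Real.circleAverage (fun ξ : ℂ => chordalPoisson r ‖ξ - z‖) 0 1 = 1 := by
    rw [Real.circleAverage_def] at hP ⊢
    have e : ∀ θ : ℝ, (poissonKernel 0 (r * z) • fun _ : ℂ => (1 : ℂ)) (circleMap 0 1 θ) =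
        ((chordalPoisson r ‖circleMap 0 1 θ - z‖ : ℝ) : ℂ) := by
      intro θ
      rw [Pi.smul_apply', poissonKernel_eq_chordalPoisson (by simp) hz]
      simp
    simp_rw [e] at hP
    rw [intervalIntegral.integral_ofReal] at hP
    rw [Complex.real_smul] at hP
    exact_mod_cast hP
  rw [Real.circleAverage_def, intervalIntegral.integral_of_le Real.two_pi_pos.le, smul_eq_mul]
    at hint
  unfold circleMeasure
  rw [lintegral_smul_measure, lintegral_map hcont.measurable.ennreal_ofReal (by fun_prop), smul_eq_mul,
    ← ofReal_integral_eq_lintegral_ofReal, ← ENNReal.ofReal_mul (by positivity)]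
  · simp_rw [circleMap_zero, Complex.ofReal_one, one_mul] at hint
    rw [hint, ENNReal.ofReal_one]
  · exact ((hcont.comp (by fun_prop :
      Continuous fun t : ℝ => Complex.exp (t * Complex.I))).integrableOn_Icc).mono_set
        Set.Ioc_subset_Icc_self
  · exact Eventually.of_forall fun t => chordalPoisson_nonneg h0 h1 _

/-- Radial limits of Poisson integrals exist wherever the symmetric derivative does. -/
lemma tendsto_lintegral_chordalPoisson {ν : Measure ℂ} [IsFiniteMeasure ν] {z : ℂ} (hz : ‖z‖ = 1)
    {L : ℝ≥0∞}
    (h : Tendsto (fun s => ν (closedBall z s) / circleMeasure (closedBall z s)) (𝓝[>] 0) (𝓝 L)) :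
    Tendsto (fun r => ∫⁻ ξ, ENNReal.ofReal (chordalPoisson r ‖ξ - z‖) ∂ν) (𝓝[<] 1) (𝓝 L) := by
  have hr : ∀ᶠ r : ℝ in 𝓝[<] 1, r ∈ Set.Ioo (0 : ℝ) 1 := Ioo_mem_nhdsLT one_pos
  have hsmall : ∀ {δ : ℝ}, 0 < δ → ∀ {C : ℝ≥0∞}, C ≠ ∞ →
      Tendsto (fun r => ENNReal.ofReal (chordalPoisson r δ) * C) (𝓝[<] 1) (𝓝 0) := by
    intro δ hδ C hC
    have := ENNReal.Tendsto.mul_const (b := C)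
      (ENNReal.tendsto_ofReal (tendsto_chordalPoisson hδ)) (Or.inr hC)
    simpa using this
  have scale : ∀ (c : ℝ≥0∞) {r : ℝ}, 0 < r → r < 1 →
      ∫⁻ ξ, ENNReal.ofReal (chordalPoisson r ‖ξ - z‖) ∂(c • circleMeasure) = c := by
    intro c r h0 h1
    rw [lintegral_smul_measure, lintegral_chordalPoisson_circleMeasure h0 h1 hz, smul_eq_mul,
      mul_one]
  have radius : ∀ {p : ℝ → Prop}, (∀ᶠ s in 𝓝[>] 0, p s) →
      ∃ δ > 0, ∀ s, 0 < s → s ≤ δ → p s := by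
    intro p hp
    obtain ⟨δ, hδ, hsub⟩ := (mem_nhdsGT_iff_exists_Ioc_subset).1 hp
    exact ⟨δ, hδ, fun s h1 h2 => hsub ⟨h1, h2⟩⟩
  refine tendsto_order.2 ⟨fun a ha => ?_, fun b hb => ?_⟩
  · obtain ⟨c, hac, hcL⟩ := exists_between ha
    have hc : c ≠ ∞ := hcL.ne_top
    obtain ⟨δ, hδ, hle⟩ := radius (h.eventually (lt_mem_nhds hcL))
    have := Measure.smul_finite circleMeasure hc
    have hlim : Tendsto (fun r => ENNReal.ofReal (chordalPoisson r δ) *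
        (c • circleMeasure) Set.univ) (𝓝[<] 1) (𝓝 0) := hsmall hδ (measure_ne_top _ _)
    have hev := hlim.eventually (gt_mem_nhds (tsub_pos_of_lt hac))
    filter_upwards [hr, hev] with r hr hev
    have key := lintegral_chordalPoisson_le (ρ := c • circleMeasure) (σ := ν) hδ
      (fun s h1 h2 => by
        rw [Measure.smul_apply, smul_eq_mul]
        refine (mul_le_mul_left (hle s h1 h2).le _).trans ?_
        rw [mul_comm]
        exact ENNReal.mul_div_le) hr.1 hr.2
    rw [scale c hr.1 hr.2] at key
    by_contra! hcon
    have : c < a + (c - a) :=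
      (key.trans (add_le_add_left hcon _)).trans_lt
        (ENNReal.add_lt_add_left hac.ne_top hev)
    rw [add_tsub_cancel_of_le hac.le] at this
    exact lt_irrefl _ this
  · obtain ⟨c, hLc, hcb⟩ := exists_between hb
    have hc : c ≠ ∞ := hcb.ne_top
    obtain ⟨δ, hδ, hle⟩ := radius (h.eventually (gt_mem_nhds hLc))
    have := Measure.smul_finite circleMeasure hc
    have hlim := hsmall hδ (measure_ne_top ν Set.univ)
    have hev := hlim.eventually (gt_mem_nhds (tsub_pos_of_lt hcb))
    filter_upwards [hr, hev] with r hr hev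
    have key := lintegral_chordalPoisson_le (ρ := ν) (σ := c • circleMeasure) hδ
      (fun s h1 h2 => by
        rw [Measure.smul_apply, smul_eq_mul]
        exact (ENNReal.div_le_iff_le_mul (Or.inr hc) (Or.inl (measure_ne_top _ _))).1
          (hle s h1 h2).le) hr.1 hr.2
    rw [scale c hr.1 hr.2] at key
    refine key.trans_lt ?_
    calc _ < c + (b - c) := ENNReal.add_lt_add_left hc hev
      _ = b := add_tsub_cancel_of_le hcb.le

lemma integrable_chordalPoisson_mul {μ : Measure ℂ} {g : ℂ → ℝ} (hg : Integrable g μ) {r : ℝ}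
    (h0 : 0 < r) (h1 : r < 1) (z : ℂ) :
    Integrable (fun ξ => chordalPoisson r ‖ξ - z‖ * g ξ) μ := by
  have hcont : Continuous fun ξ : ℂ => chordalPoisson r ‖ξ - z‖ :=
    (continuous_chordalPoisson h0 h1).comp (by fun_prop)
  refine hg.bdd_mul (c := chordalPoisson r 0) hcont.aestronglyMeasurable
    (Eventually.of_forall fun ξ => ?_)
  rw [Real.norm_of_nonneg (chordalPoisson_nonneg h0 h1 _)]
  exact chordalPoisson_anti h0 h1 le_rfl (norm_nonneg _)

/-- Fatou's theorem for Poisson integrals of nonnegative densities. -/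
lemma ae_tendsto_integral_chordalPoisson_of_nonneg {μ : Measure ℂ} [IsFiniteMeasure μ] {g : ℂ → ℝ}
    (hgm : Measurable g) (hg : Integrable g μ) (hg0 : 0 ≤ g) :
    ∀ᵐ z ∂circleMeasure,
      Tendsto (fun r => ∫ ξ, chordalPoisson r ‖ξ - z‖ * g ξ ∂μ) (𝓝[<] 1)
        (𝓝 ((μ.rnDeriv circleMeasure z).toReal * g z)) := by
  set ν := μ.withDensity fun ξ => ENNReal.ofReal (g ξ) with hν
  have : IsFiniteMeasure ν := isFiniteMeasure_withDensity_ofReal hg.2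
  filter_upwards [ae_circleMeasure_norm_eq_one, Besicovitch.ae_tendsto_rnDeriv ν circleMeasure,
    Measure.rnDeriv_withDensity_left (μ := μ) (ν := circleMeasure)
      (f := fun ξ => ENNReal.ofReal (g ξ)) hgm.ennreal_ofReal.aemeasurable
      (Eventually.of_forall fun _ => ENNReal.ofReal_ne_top),
    Measure.rnDeriv_lt_top μ circleMeasure] with z hz hlim hderiv hfin
  rw [← hν] at hderiv
  have ht := tendsto_lintegral_chordalPoisson hz hlim
  rw [hderiv] at ht
  have ht' := (ENNReal.tendsto_toReal (ENNReal.mul_ne_top ENNReal.ofReal_ne_top hfin.ne)).comp ht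
  rw [ENNReal.toReal_mul, ENNReal.toReal_ofReal (hg0 z), mul_comm] at ht'
  refine ht'.congr' ?_
  filter_upwards [Ioo_mem_nhdsLT (zero_lt_one (α := ℝ))] with r hr
  have hcont : Continuous fun ξ : ℂ => chordalPoisson r ‖ξ - z‖ :=
    (continuous_chordalPoisson hr.1 hr.2).comp (by fun_prop)
  rw [integral_eq_lintegral_of_nonneg_ae
    (Eventually.of_forall fun ξ => mul_nonneg (chordalPoisson_nonneg hr.1 hr.2 _) (hg0 ξ))
    (integrable_chordalPoisson_mul hg hr.1 hr.2 z).aestronglyMeasurable]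
  simp only [Function.comp_apply]
  rw [hν, lintegral_withDensity_eq_lintegral_mul _ hgm.ennreal_ofReal
    hcont.measurable.ennreal_ofReal]
  congr 1
  refine lintegral_congr fun ξ => ?_
  rw [Pi.mul_apply, mul_comm, ENNReal.ofReal_mul (chordalPoisson_nonneg hr.1 hr.2 _)]

lemma ae_tendsto_integral_chordalPoisson_real {μ : Measure ℂ} [IsFiniteMeasure μ] {g : ℂ → ℝ}
    (hgm : Measurable g) (hg : Integrable g μ) :
    ∀ᵐ z ∂circleMeasure,
      Tendsto (fun r => ∫ ξ, chordalPoisson r ‖ξ - z‖ * g ξ ∂μ) (𝓝[<] 1)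
        (𝓝 ((μ.rnDeriv circleMeasure z).toReal * g z)) := by
  filter_upwards [ae_tendsto_integral_chordalPoisson_of_nonneg
      (g := fun ξ => max (g ξ) 0) (by fun_prop) hg.pos_part (fun _ => le_max_right _ _),
    ae_tendsto_integral_chordalPoisson_of_nonneg
      (g := fun ξ => max (-g ξ) 0) (by fun_prop) hg.neg_part (fun _ => le_max_right _ _)]
    with z hp hn
  have hsub : ∀ x : ℝ, max x 0 - max (-x) 0 = x := fun x => by
    rcases le_total x 0 with h | h <;> simp [h]
  have ht := hp.sub hn
  rw [← mul_sub, hsub] at ht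
  refine ht.congr' ?_
  filter_upwards [Ioo_mem_nhdsLT (zero_lt_one (α := ℝ))] with r hr
  rw [← integral_sub (integrable_chordalPoisson_mul hg.pos_part hr.1 hr.2 z)
    (integrable_chordalPoisson_mul hg.neg_part hr.1 hr.2 z)]
  simp_rw [← mul_sub, hsub]

/-- **Fatou's theorem**: the Poisson integral of the complex measure `f dμ` has radial limit
`w f` almost everywhere, where `w` is the density of `μ`. -/
lemma ae_tendsto_integral_chordalPoisson {μ : Measure ℂ} [IsFiniteMeasure μ] {f : ℂ → ℂ}
    (hfm : Measurable f) (hf : Integrable f μ) :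
    ∀ᵐ z ∂circleMeasure,
      Tendsto (fun r => ∫ ξ, (chordalPoisson r ‖ξ - z‖ : ℂ) * f ξ ∂μ) (𝓝[<] 1)
        (𝓝 (((μ.rnDeriv circleMeasure z).toReal : ℂ) * f z)) := by
  filter_upwards [ae_tendsto_integral_chordalPoisson_real (g := fun ξ => (f ξ).re)
      (by fun_prop) hf.re,
    ae_tendsto_integral_chordalPoisson_real (g := fun ξ => (f ξ).im) (by fun_prop) hf.im]
    with z hre him
  have ht := ((Complex.continuous_ofReal.tendsto _).comp hre).add
    (((Complex.continuous_ofReal.tendsto _).comp him).mul_const Complex.I)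
  have e : ∀ (a : ℝ) (b : ℂ), (a : ℂ) * b = ((a * b.re : ℝ) : ℂ) + ((a * b.im : ℝ) : ℂ) * I := by
    intro a b
    apply Complex.ext <;> simp
  rw [e]
  refine ht.congr' ?_
  filter_upwards [Ioo_mem_nhdsLT (zero_lt_one (α := ℝ))] with r hr
  simp only [Function.comp_apply]
  rw [show (fun ξ => (chordalPoisson r ‖ξ - z‖ : ℂ) * f ξ) = _ from funext fun ξ => e _ _]
  rw [integral_add (integrable_chordalPoisson_mul hf.re hr.1 hr.2 z).ofReal
    ((integrable_chordalPoisson_mul hf.im hr.1 hr.2 z).ofReal.mul_const _), integral_mul_const]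
  simp only [integral_complex_ofReal]

lemma abs_one_sub_norm_le {ξ lam : ℂ} (hξ : ‖ξ‖ = 1) : |1 - ‖lam‖| ≤ ‖1 - conj ξ * lam‖ := by
  have := abs_norm_sub_norm_le 1 (conj ξ * lam)
  simpa [hξ] using this

lemma integrable_div_one_sub_conj_mul {μ : Measure ℂ} (hμ : ∀ᵐ ξ ∂μ, ‖ξ‖ = 1) {f : ℂ → ℂ}
    (hf : Integrable f μ) {lam : ℂ} (hlam : ‖lam‖ ≠ 1) :
    Integrable (fun ξ => f ξ / (1 - conj ξ * lam)) μ := by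
  have hpos : 0 < |1 - ‖lam‖| := abs_pos.2 (sub_ne_zero.2 hlam.symm)
  have hm : Measurable fun ξ : ℂ => (1 - conj ξ * lam)⁻¹ :=
    (by fun_prop : Continuous fun ξ : ℂ => 1 - conj ξ * lam).measurable.inv
  simp_rw [div_eq_inv_mul]
  refine hf.bdd_mul (c := |1 - ‖lam‖|⁻¹) hm.aestronglyMeasurable ?_
  filter_upwards [hμ] with ξ hξ
  rw [norm_inv]
  exact inv_anti₀ hpos (abs_one_sub_norm_le hξ)

/-- The jump of the Cauchy kernel across the unit circle is the Poisson kernel. -/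
lemma cauchy_sub_cauchy_eq_chordalPoisson {r : ℝ} (h0 : 0 < r) (h1 : r < 1) {ξ z : ℂ}
    (hξ : ‖ξ‖ = 1) (hz : ‖z‖ = 1) (a : ℂ) :
    a / (1 - conj ξ * (r * z)) - a / (1 - conj ξ * ((r : ℂ)⁻¹ * z)) =
      (chordalPoisson r ‖ξ - z‖ : ℂ) * a := by
  have hr : (r : ℂ) ≠ 0 := by exact_mod_cast h0.ne'
  have hξξ : ξ * conj ξ = 1 := by rw [Complex.mul_conj, Complex.normSq_eq_norm_sq, hξ]; simp
  have hzz : z * conj z = 1 := by rw [Complex.mul_conj, Complex.normSq_eq_norm_sq, hz]; simp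
  have hD : ((1 - r : ℂ) ^ 2 + r * (‖ξ - z‖ : ℂ) ^ 2) = (1 - r * (conj ξ * z)) *
      (1 - r * (ξ * conj z)) := by
    have : ((‖ξ - z‖ : ℂ) ^ 2) = (ξ - z) * (conj ξ - conj z) := by
      rw [← map_sub, Complex.mul_conj, Complex.normSq_eq_norm_sq]
      push_cast
      rfl
    rw [this]
    linear_combination (r - r ^ 2 * z * conj z) * hξξ + (r - r ^ 2) * hzz
  have hD0 : ((1 - r : ℂ) ^ 2 + r * (‖ξ - z‖ : ℂ) ^ 2) ≠ 0 := by
    exact_mod_cast (chordalPoisson_denom_pos h0 h1 ‖ξ - z‖).ne'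
  have hA : 1 - r * (conj ξ * z) ≠ 0 := fun h => hD0 (by rw [hD, h, zero_mul])
  have hB : 1 - r * (ξ * conj z) ≠ 0 := fun h => hD0 (by rw [hD, h, mul_zero])
  have h1u : conj ξ * z * (ξ * conj z) = 1 := by linear_combination z * conj z * hξξ + hzz
  have hu : conj ξ * z ≠ 0 := left_ne_zero_of_mul_eq_one h1u
  have hK : (chordalPoisson r ‖ξ - z‖ : ℂ) =
      (1 - (r : ℂ) ^ 2) / ((1 - r * (conj ξ * z)) * (1 - r * (ξ * conj z))) := by
    rw [← hD]
    simp [chordalPoisson]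
  rw [hK, show conj ξ * (r * z) = r * (conj ξ * z) by ring,
    show conj ξ * ((r : ℂ)⁻¹ * z) = (r : ℂ)⁻¹ * (conj ξ * z) by ring]
  generalize conj ξ * z = u at *
  generalize ξ * conj z = v at *
  generalize (r : ℂ) = ρ at *
  have h2 : 1 - ρ⁻¹ * u = -(1 - ρ * v) * (ρ⁻¹ * u) := by
    field_simp
    linear_combination -ρ * h1u
  have h3 : a / (1 - ρ⁻¹ * u) = -(a * ρ * v) / (1 - ρ * v) := by
    rw [h2, div_eq_div_iff (mul_ne_zero (neg_ne_zero.2 hB) (mul_ne_zero (inv_ne_zero hr) hu)) hB]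
    field_simp
    linear_combination -a * h1u
  rw [h3]
  field_simp
  linear_combination (-a * ρ ^ 2) * h1u

/-- For every `f ∈ L²(μ)`, `T₊f - T₋f = w f` Lebesgue-a.e. on `𝕋`,
where `w = dμ_ac/dm` and `T₊f`, `T₋f` are the interior/exterior nontangential boundary
values of the Cauchy transform `R(fμ)`. -/
theorem statement16
    (μ : Measure ℂ) [IsProbabilityMeasure μ] (hμ : ∀ᵐ ξ ∂μ, ‖ξ‖ = 1)
    (f : Lp ℂ 2 μ) (Tpf Tmf : ℂ → ℂ)
    (hTpf : ∀ᵐ z ∂circleMeasure,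
      NTlimIn (fun lam => ∫ ξ, f ξ / (1 - conj ξ * lam) ∂μ) z (Tpf z))
    (hTmf : ∀ᵐ z ∂circleMeasure,
      NTlimOut (fun lam => ∫ ξ, f ξ / (1 - conj ξ * lam) ∂μ) z (Tmf z)) :
    ∀ᵐ z ∂circleMeasure,
      Tpf z - Tmf z = ((μ.rnDeriv circleMeasure z).toReal : ℂ) * f z := by
  have hf : Integrable f μ := (Lp.memLp f).integrable (by norm_num)
  have hfm : Measurable f := (Lp.stronglyMeasurable f).measurable
  filter_upwards [hTpf, hTmf, ae_circleMeasure_norm_eq_one,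
    ae_tendsto_integral_chordalPoisson hfm hf] with z hp hm hz hlim
  have hr : ∀ᶠ r : ℝ in 𝓝[<] 1, r ∈ Set.Ioo (0 : ℝ) 1 := Ioo_mem_nhdsLT one_pos
  have hin : Tendsto (fun r : ℝ => (r : ℂ) * z) (𝓝[<] 1)
      (𝓝[{w : ℂ | ‖w‖ < 1 ∧ ‖w - z‖ ≤ 2 * (1 - ‖w‖)}] z) := by
    refine tendsto_nhdsWithin_iff.2 ⟨?_, ?_⟩
    · have : ContinuousAt (fun r : ℝ => (r : ℂ) * z) 1 := by fun_prop
      simpa using this.tendsto.mono_left (nhdsWithin_le_nhds (s := Set.Iio 1))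
    · filter_upwards [hr] with r hr
      have e : (r : ℂ) * z - z = ((r - 1 : ℝ) : ℂ) * z := by push_cast; ring
      simp only [e, norm_mul, hz, mul_one, Complex.norm_real, Real.norm_eq_abs,
        abs_of_pos hr.1, abs_of_neg (sub_neg.2 hr.2)]
      exact ⟨hr.2, by linarith [hr.2]⟩
  have hout : Tendsto (fun r : ℝ => (r : ℂ)⁻¹ * z) (𝓝[<] 1)
      (𝓝[{w : ℂ | 1 < ‖w‖ ∧ ‖w - z‖ ≤ 2 * (‖w‖ - 1)}] z) := by
    refine tendsto_nhdsWithin_iff.2 ⟨?_, ?_⟩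
    · have : ContinuousAt (fun r : ℝ => (r : ℂ)⁻¹ * z) 1 :=
        (Complex.continuous_ofReal.continuousAt.inv₀ (by simp)).mul continuousAt_const
      simpa using this.tendsto.mono_left (nhdsWithin_le_nhds (s := Set.Iio 1))
    · filter_upwards [hr] with r hr
      have h1 : 1 < r⁻¹ := (one_lt_inv₀ hr.1).2 hr.2
      have e : (r : ℂ)⁻¹ * z - z = ((r⁻¹ - 1 : ℝ) : ℂ) * z := by push_cast; ring
      simp only [e, norm_mul, hz, mul_one, Complex.norm_real, Real.norm_eq_abs,
        norm_inv, abs_of_pos hr.1, abs_of_pos (sub_pos.2 h1)]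
      exact ⟨h1, by linarith⟩
  refine tendsto_nhds_unique
    (((hp 2 one_lt_two).comp hin).sub ((hm 2 one_lt_two).comp hout)) (hlim.congr' ?_)
  filter_upwards [hr] with r hr
  have hnin : ‖(r : ℂ) * z‖ ≠ 1 := by
    simp [hz, abs_of_pos hr.1, hr.2.ne]
  have hnout : ‖(r : ℂ)⁻¹ * z‖ ≠ 1 := by
    simp [hz, abs_of_pos hr.1, hr.2.ne]
  simp only [Function.comp_apply]
  rw [← integral_sub (integrable_div_one_sub_conj_mul hμ hf hnin)
    (integrable_div_one_sub_conj_mul hμ hf hnout)]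
  refine integral_congr_ae ?_
  filter_upwards [hμ] with ξ hξ
  exact (cauchy_sub_cauchy_eq_chordalPoisson hr.1 hr.2 hξ hz (f ξ)).symm
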